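/- Let F = ℚ(a, t) be the field of rational functions in two variables a, t over ℚ and fix γ ∈ F. If ψ′ is any function from Young diagrams to F satisfying, for every nonempty Young diagram μ, the recursion (t − t^{−1}) · C_μ(t) · ψ′_μ = γ · Σ_{λ : λ+□=μ} (a t^{2 c(μ∖λ)} − a^{−1}) · ψ′_λ, then for every Young diagram λ one has ψ′_λ = ψ′_∅ · γ^{|λ|} · ∏_{□∈λ} (a t^{c(□)} − a^{−1} t^{−c(□)}) / (t^{h(□)} − t^{−h(□)}). In particular any solution of the recursion is a scalar multiple of this hook-content solution. -/

import Mathlib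

open Finset

/-- The content of a cell `(i, j)` (0-indexed) of a Young diagram: `j - i`. -/
def cellContent (c : ℕ × ℕ) : ℤ := (c.2 : ℤ) - (c.1 : ℤ)

/-- The arm length of a cell: number of cells strictly to its right in its row. -/
def armLen (μ : YoungDiagram) (c : ℕ × ℕ) : ℕ := μ.rowLen c.1 - (c.2 + 1)

/-- The leg length of a cell: number of cells strictly below it in its column. -/
def legLen (μ : YoungDiagram) (c : ℕ × ℕ) : ℕ := μ.colLen c.2 - (c.1 + 1)

/-- The hook length of a cell: arm + leg + 1. -/
def hookLen (μ : YoungDiagram) (c : ℕ × ℕ) : ℕ := armLen μ c + legLen μ c + 1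

/-- `AddCell l m` means `m` is obtained from `l` by adding exactly one cell. -/
def AddCell (l m : YoungDiagram) : Prop := l.cells ⊆ m.cells ∧ m.card = l.card + 1

/-- The content of the unique cell of `m` not in `l` (when `AddCell l m`),
expressed as the sum over the one-element difference `m \ l`. -/
def newContent (l m : YoungDiagram) : ℤ := ∑ c ∈ m.cells \ l.cells, cellContent c

/-- The field `ℚ(a,t)` of rational functions in two variables over `ℚ`, realized as
rational functions in `t` over the field `ℚ(a)`. -/
abbrev F2 : Type := RatFunc (RatFunc ℚ)

/-- The variable `a` of `ℚ(a,t)`. -/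
noncomputable def va : F2 := RatFunc.C RatFunc.X

/-- The variable `t` of `ℚ(a,t)`. -/
noncomputable def vt : F2 := RatFunc.X

/-- The content polynomial `c_μ(q) = Σ_{□∈μ} q^{c(□)}` evaluated at `q = t²`,
as an element of `ℚ(a,t)`. -/
noncomputable def contentPolyT2 (μ : YoungDiagram) : F2 :=
  ∑ c ∈ μ.cells, vt ^ (2 * cellContent c)

section UnkAux
open Polynomial in
theorem unk_lag_B {K : Type*} [Field K] (s : Finset ℕ) (hs : s.Nonempty) (X : ℕ → K)
    (hX : Set.InjOn X s) (q : K) (hq : q ≠ 1) :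
    ∑ i ∈ s, X i * ∏ j ∈ s.erase i, ((X i - q * X j) / (X i - X j)) = ∑ i ∈ s, X i := by
  set G : K[X] := ∏ j ∈ s, (Polynomial.X - C (q * X j)) with hG
  set N : K[X] := ∏ j ∈ s, (Polynomial.X - C (X j)) with hN
  have hcp : 0 < s.card := hs.card_pos
  have hGm : G.Monic := monic_prod_X_sub_C _ _
  have hNm : N.Monic := monic_prod_X_sub_C _ _
  have hGd : G.degree = s.card := by rw [hG, degree_prod]; simp [-map_mul]
  have hNd : N.degree = s.card := by rw [hN, degree_prod]; simp
  have hdeg : (G - N).degree < s.card := by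
    rw [← hGd]
    exact degree_sub_lt_left (by rw [hGd, hNd]) hGm.ne_zero (by rw [hGm.leadingCoeff, hNm.leadingCoeff])
  have h := Lagrange.coeff_eq_sum hX hdeg
  rw [coeff_sub, hG, hN, prod_X_sub_C_coeff_card_pred _ _ hcp, prod_X_sub_C_coeff_card_pred _ _ hcp,
    ← Finset.mul_sum, ← hG, ← hN] at h
  have hq' : (1 - q) ≠ 0 := sub_ne_zero.2 hq.symm
  apply mul_left_cancel₀ hq'
  rw [show (1 - q) * ∑ i ∈ s, X i = -(q * ∑ i ∈ s, X i) - -∑ i ∈ s, X i by ring, h, Finset.mul_sum]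
  refine Finset.sum_congr rfl fun i hi => ?_
  have e1 : eval (X i) N = 0 := by
    rw [hN, eval_prod]; exact Finset.prod_eq_zero hi (by simp)
  have e2 : eval (X i) G = (X i - q * X i) * ∏ j ∈ s.erase i, (X i - q * X j) := by
    rw [hG, eval_prod, ← Finset.mul_prod_erase _ _ hi]; simp
  rw [eval_sub, e1, e2, Finset.prod_div_distrib]; ring

open Polynomial in
theorem unk_lag_A {K : Type*} [Field K] (s : Finset ℕ) (hs : s.Nonempty) (X : ℕ → K)
    (hX : Set.InjOn X s) (hX0 : ∀ i, X i ≠ 0) (q : K) :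
    (1 - q) * ∑ i ∈ s, ∏ j ∈ s.erase i, ((X i - q * X j) / (X i - X j)) = 1 - q ^ s.card := by
  set G : K[X] := ∏ j ∈ s, (Polynomial.X - C (q * X j)) with hG
  set N : K[X] := ∏ j ∈ s, (Polynomial.X - C (X j)) with hN
  have hcp : 0 < s.card := hs.card_pos
  have hGm : G.Monic := monic_prod_X_sub_C _ _
  have hNm : N.Monic := monic_prod_X_sub_C _ _
  have hGd : G.natDegree = s.card := by rw [hG]; exact (natDegree_prod_of_monic _ _ (fun i _ => monic_X_sub_C _)).trans (by simp [-map_mul])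
  have hNd : N.natDegree = s.card := by rw [hN]; simp
  set P : K[X] := G - C (q ^ s.card) * N with hP
  have hPd : P.natDegree ≤ s.card := by
    refine (natDegree_sub_le _ _).trans (max_le hGd.le ((natDegree_C_mul_le _ _).trans hNd.le))
  have hP0 : P.coeff 0 = 0 := by
    rw [coeff_zero_eq_eval_zero, hP, eval_sub, eval_mul, eval_C, hG, hN, eval_prod, eval_prod]
    simp only [eval_sub, eval_X, eval_C, zero_sub]
    simp_rw [← mul_neg]
    rw [Finset.prod_mul_distrib, Finset.prod_const]; ring
  have hdeg : P.divX.degree < s.card := by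
    rcases eq_or_ne P.divX 0 with h0 | h0
    · rw [h0]; simp
    · rw [degree_eq_natDegree h0, natDegree_divX_eq_natDegree_tsub_one]
      exact_mod_cast (by omega)
  have h := Lagrange.coeff_eq_sum hX hdeg
  rw [coeff_divX, Nat.sub_add_cancel hcp] at h
  have hc : P.coeff s.card = 1 - q ^ s.card := by
    rw [hP, coeff_sub, coeff_C_mul]
    have c1 := hGm.coeff_natDegree
    have c2 := hNm.coeff_natDegree
    rw [hGd] at c1
    rw [hNd] at c2
    rw [c1, c2, mul_one]
  rw [← hc, h, Finset.mul_sum]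
  refine Finset.sum_congr rfl fun i hi => ?_
  have e1 : eval (X i) N = 0 := by
    rw [hN, eval_prod]; exact Finset.prod_eq_zero hi (by simp)
  have e2 : eval (X i) G = (X i - q * X i) * ∏ j ∈ s.erase i, (X i - q * X j) := by
    rw [hG, eval_prod, ← Finset.mul_prod_erase _ _ hi]; simp
  have e3 : eval (X i) P.divX * X i = eval (X i) P := by
    conv_rhs => rw [← divX_mul_X_add P, hP0]
    simp
  have e4 : eval (X i) P.divX = (1 - q) * ∏ j ∈ s.erase i, (X i - q * X j) := by
    apply mul_right_cancel₀ (hX0 i)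
    rw [e3, hP, eval_sub, eval_mul, e1, e2]; ring
  rw [e4, Finset.prod_div_distrib]; ring

theorem unk_rowLen_le {μ : YoungDiagram} {i j : ℕ} : μ.rowLen i ≤ j ↔ μ.colLen j ≤ i := by
  have h1 := @YoungDiagram.mem_iff_lt_rowLen μ i j
  have h2 := @YoungDiagram.mem_iff_lt_colLen μ i j
  have := h1.symm.trans h2
  omega

/-- Hook lengths in row `r` and the differences of beta numbers complement each other. -/
theorem unk_compl {M : Type*} [CommMonoid M] (f : ℤ → M) (μ : YoungDiagram) (r n : ℕ)
    (hn : μ.colLen 0 ≤ n) (hr : r < n) :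
    (∏ j ∈ range (μ.rowLen r), f (hookLen μ (r, j))) *
      ∏ i ∈ Ico (r + 1) n, f (((μ.rowLen r : ℤ) - r) - (μ.rowLen i - i)) =
    ∏ m ∈ Ico 1 (μ.rowLen r + n - r), f (m : ℤ) := by
  have hhook : ∀ j, j < μ.rowLen r → hookLen μ (r, j) + (r + j + 1) = μ.rowLen r + μ.colLen j ∧
      r < μ.colLen j ∧ μ.colLen j ≤ n := by
    intro j hj
    have h1 : r < μ.colLen j :=
      YoungDiagram.mem_iff_lt_colLen.1 (YoungDiagram.mem_iff_lt_rowLen.2 hj)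
    have h2 := μ.colLen_anti 0 j (Nat.zero_le _)
    simp only [hookLen, armLen, legLen]
    omega
  have key : ∀ i j, i < μ.colLen j ↔ j < μ.rowLen i := fun i j => by
    have := @unk_rowLen_le μ i j; omega
  let g : ℕ → ℕ := fun i => (μ.rowLen r + i) - (r + μ.rowLen i)
  have hg : ∀ i, r < i → g i + r + μ.rowLen i = μ.rowLen r + i ∧ r + μ.rowLen i < μ.rowLen r + i := by
    intro i hi
    have := μ.rowLen_anti r i hi.le
    simp only [g]; omega
  have inj1 : Set.InjOn (fun j => hookLen μ (r, j)) (range (μ.rowLen r) : Finset ℕ) := by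
    intro a ha b hb hab
    simp only [coe_range, Set.mem_Iio] at ha hb hab
    have h1 := hhook a ha
    have h2 := hhook b hb
    rcases le_total a b with h | h
    · have := μ.colLen_anti a b h; omega
    · have := μ.colLen_anti b a h; omega
  have inj2 : Set.InjOn g (Ico (r + 1) n : Finset ℕ) := by
    intro a ha b hb hab
    simp only [coe_Ico, Set.mem_Ico] at ha hb
    have h1 := hg a (by omega)
    have h2 := hg b (by omega)
    rcases le_total a b with h | h
    · have := μ.rowLen_anti a b h; omega
    · have := μ.rowLen_anti b a h; omega
  have hdisj : Disjoint ((range (μ.rowLen r)).image (fun j => hookLen μ (r, j)))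
      ((Ico (r + 1) n).image g) := by
    rw [Finset.disjoint_left]
    intro x hx hy
    obtain ⟨j, hj, rfl⟩ := mem_image.1 hx
    obtain ⟨i, hi, hij⟩ := mem_image.1 hy
    rw [mem_range] at hj
    rw [mem_Ico] at hi
    have h1 := hhook j hj
    have h2 := hg i (by omega)
    have h3 := key i j
    omega
  have hunion : ((range (μ.rowLen r)).image (fun j => hookLen μ (r, j))) ∪
      ((Ico (r + 1) n).image g) = Ico 1 (μ.rowLen r + n - r) := by
    apply Finset.eq_of_subset_of_card_le
    · intro x hx
      rw [mem_union] at hx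
      rw [mem_Ico]
      rcases hx with hx | hx
      · obtain ⟨j, hj, rfl⟩ := mem_image.1 hx
        rw [mem_range] at hj
        have h1 := hhook j hj
        omega
      · obtain ⟨i, hi, rfl⟩ := mem_image.1 hx
        rw [mem_Ico] at hi
        have h2 := hg i (by omega)
        omega
    · rw [card_union_of_disjoint hdisj, card_image_of_injOn inj1, card_image_of_injOn inj2]
      simp
      omega
  rw [← hunion, prod_union hdisj, prod_image inj1, prod_image inj2]
  congr 1
  refine prod_congr rfl fun i hi => ?_
  rw [mem_Ico] at hi
  have h2 := hg i (by omega)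
  congr 1
  omega

theorem unk_lt_ext {a b : ℕ} (h : ∀ j, j < a ↔ j < b) : a = b := by
  have h1 := h a
  have h2 := h b
  omega

theorem unk_one {a b s : ℕ} (h : ∀ j, j < b ↔ j = s ∨ j < a) (hs : ¬ s < a) :
    a = s ∧ b = s + 1 := by
  have h1 := h s
  have h2 := h (s + 1)
  have h3 := h (s - 1)
  omega

theorem unk_rows {l μ : YoungDiagram} {r s : ℕ} (hrs : (r, s) ∉ l.cells)
    (hμ : μ.cells = insert (r, s) l.cells) :
    (l.rowLen r = s ∧ μ.rowLen r = s + 1) ∧ (l.colLen s = r ∧ μ.colLen s = r + 1) ∧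
    (∀ i, i ≠ r → l.rowLen i = μ.rowLen i) ∧ (∀ j, j ≠ s → l.colLen j = μ.colLen j) := by
  have hm : ∀ i j, (i, j) ∈ μ ↔ (i = r ∧ j = s) ∨ (i, j) ∈ l := by
    intro i j
    rw [← YoungDiagram.mem_cells, hμ, mem_insert, YoungDiagram.mem_cells, Prod.mk.injEq]
  rw [YoungDiagram.mem_cells] at hrs
  refine ⟨unk_one (fun j => ?_) ?_, unk_one (fun j => ?_) ?_, fun i hi => unk_lt_ext fun j => ?_,
    fun j hj => unk_lt_ext fun i => ?_⟩
  · rw [← YoungDiagram.mem_iff_lt_rowLen, ← YoungDiagram.mem_iff_lt_rowLen, hm]; simp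
  · rwa [← YoungDiagram.mem_iff_lt_rowLen]
  · rw [← YoungDiagram.mem_iff_lt_colLen, ← YoungDiagram.mem_iff_lt_colLen, hm]; simp
  · rwa [← YoungDiagram.mem_iff_lt_colLen]
  · rw [← YoungDiagram.mem_iff_lt_rowLen, ← YoungDiagram.mem_iff_lt_rowLen, hm]; simp [hi]
  · rw [← YoungDiagram.mem_iff_lt_colLen, ← YoungDiagram.mem_iff_lt_colLen, hm]; simp [hj]

/-- quantum bracket -/
def unkBr {K : Type*} [Field K] (t : K) (m : ℤ) : K := t ^ m - t ^ (-m)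

theorem unkBr_neg {K : Type*} [Field K] (t : K) (m : ℤ) : unkBr t (-m) = - unkBr t m := by
  simp [unkBr]

theorem unkBr_ne {K : Type*} [Field K] (t : K) (ht : t ≠ 0) (hnz : ∀ m : ℤ, m ≠ 0 → t ^ m ≠ 1)
    (m : ℤ) (hm : m ≠ 0) : unkBr t m ≠ 0 := by
  intro h
  apply hnz (m + m) (by omega)
  rw [unkBr, sub_eq_zero] at h
  rw [zpow_add₀ ht]
  nth_rw 1 [h]
  rw [← zpow_add₀ ht]; simp

/-- beta number -/
def unkL (μ : YoungDiagram) (i : ℕ) : ℤ := (μ.rowLen i : ℤ) - i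

/-- the ratio of hook products -/
noncomputable def unkR {K : Type*} [Field K] (t : K) (μ : YoungDiagram) (n r : ℕ) : K :=
  unkBr t (unkL μ r + n - 1) * ∏ j ∈ (range n).erase r,
    (unkBr t (unkL μ r - 1 - unkL μ j) / unkBr t (unkL μ r - unkL μ j))

theorem unk_ratio {K : Type*} [Field K] (t : K) (ht : t ≠ 0) (hnz : ∀ m : ℤ, m ≠ 0 → t ^ m ≠ 1)
    {l μ : YoungDiagram} {r s : ℕ} (hrs : (r, s) ∉ l.cells)
    (hμ : μ.cells = insert (r, s) l.cells) (n : ℕ) (hn : μ.colLen 0 ≤ n) (hr : r < n) :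
    ∏ c ∈ μ.cells, unkBr t (hookLen μ c) = (∏ c ∈ l.cells, unkBr t (hookLen l c)) * unkR t μ n r := by
  have hb := unkBr_ne t ht hnz
  obtain ⟨⟨hlr, hmr⟩, ⟨hlc, hmc⟩, hrow, hcol⟩ := unk_rows hrs hμ
  have key : ∀ i j, (i, j) ∈ l.cells → j < l.rowLen i ∧ i < l.colLen j := fun i j h =>
    ⟨YoungDiagram.mem_iff_lt_rowLen.1 h, YoungDiagram.mem_iff_lt_colLen.1 h⟩
  -- product over cells of l of ratios
  have hA : ∏ c ∈ l.cells, (unkBr t (hookLen μ c) / unkBr t (hookLen l c)) =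
      (∏ j ∈ range s, (unkBr t (hookLen μ (r, j)) / unkBr t (hookLen l (r, j)))) *
      ∏ i ∈ range r, (unkBr t (hookLen μ (i, s)) / unkBr t (hookLen l (i, s))) := by
    have i1 : Set.InjOn (fun j : ℕ => (r, j)) (range s : Finset ℕ) := fun a _ b _ h => by
      simpa using h
    have i2 : Set.InjOn (fun i : ℕ => (i, s)) (range r : Finset ℕ) := fun a _ b _ h => by
      simpa using h
    have hd : Disjoint ((range s).image (fun j : ℕ => (r, j)))
        ((range r).image (fun i : ℕ => (i, s))) := by
      rw [Finset.disjoint_left]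
      intro x hx hy
      simp only [mem_image, mem_range] at hx hy
      obtain ⟨j, hj, rfl⟩ := hx
      obtain ⟨i, hi, h⟩ := hy
      simp only [Prod.mk.injEq] at h
      omega
    rw [← prod_image (f := fun c => unkBr t (hookLen μ c) / unkBr t (hookLen l c)) i1,
      ← prod_image (f := fun c => unkBr t (hookLen μ c) / unkBr t (hookLen l c)) i2,
      ← prod_union hd]
    symm
    apply prod_subset
    · intro x hx
      rw [mem_union] at hx
      simp only [mem_image, mem_range] at hx
      rcases hx with ⟨j, hj, rfl⟩ | ⟨i, hi, rfl⟩
      · exact YoungDiagram.mem_iff_lt_rowLen.2 (by omega)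
      · exact YoungDiagram.mem_iff_lt_colLen.2 (by omega)
    · rintro ⟨i, j⟩ hx hnx
      have hk := key i j hx
      simp only [mem_union, mem_image, mem_range, not_or, not_exists, Prod.mk.injEq, not_and] at hnx
      have hir : i ≠ r := by
        rintro rfl
        exact hnx.1 j (by omega) rfl rfl
      have hjs : j ≠ s := by
        rintro rfl
        exact hnx.2 i (by omega) rfl rfl
      have : hookLen μ (i, j) = hookLen l (i, j) := by
        simp only [hookLen, armLen, legLen, hrow i hir, hcol j hjs]
      rw [this]
      exact div_self (hb _ (by simp only [hookLen]; omega))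
  have hcolm : ∀ j, j < s → r < μ.colLen j := fun j hj => by
    rw [← hcol j (by omega)]
    exact YoungDiagram.mem_iff_lt_colLen.1 (YoungDiagram.mem_iff_lt_rowLen.2 (by omega))
  have hrowm : ∀ i, i < r → s < μ.rowLen i := fun i hi => by
    rw [← hrow i (by omega)]
    exact YoungDiagram.mem_iff_lt_rowLen.1 (YoungDiagram.mem_iff_lt_colLen.2 (by omega))
  have hbelow : ∀ i, r < i → μ.rowLen i ≤ s := fun i hi => by
    rw [unk_rowLen_le]; omega
  have hcorner : hookLen μ (r, s) = 1 := by
    simp only [hookLen, armLen, legLen]; omega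
  -- row part
  have hrowl : ∀ j, j < s → (hookLen l (r, j) : ℤ) = hookLen μ (r, j) - 1 ∧
      2 ≤ hookLen μ (r, j) := fun j hj => by
    have := hcolm j hj
    simp only [hookLen, armLen, legLen, hcol j (by omega)]
    omega
  set M : ℕ := s + n - r with hM
  have c1 := unk_compl (unkBr t) μ r n hn hr
  have c2 := unk_compl (fun m => if m = 1 then 1 else unkBr t (m - 1)) μ r n hn hr
  have hM' : μ.rowLen r + n - r = M + 1 := by omega
  rw [hM', hmr, prod_range_succ, hcorner] at c1 c2
  have hM1 : 1 ≤ M := by omega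
  rw [prod_Ico_succ_top hM1] at c1
  rw [prod_eq_prod_Ico_succ_bot (by omega : 1 < M + 1), ← prod_Ico_add' _ 1 M 1] at c2
  have d1 : ∏ m ∈ Ico 1 M, (if ((m + 1 : ℕ) : ℤ) = 1 then (1 : K) else
      unkBr t (((m + 1 : ℕ) : ℤ) - 1)) = ∏ m ∈ Ico 1 M, unkBr t (m : ℤ) := by
    refine prod_congr rfl fun m hm => ?_
    rw [mem_Ico] at hm
    rw [if_neg (by omega)]
    congr 1
    omega
  have d2 : ∏ j ∈ range s, (if (hookLen μ (r, j) : ℤ) = 1 then (1 : K) else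
      unkBr t ((hookLen μ (r, j) : ℤ) - 1)) = ∏ j ∈ range s, unkBr t (hookLen l (r, j)) := by
    refine prod_congr rfl fun j hj => ?_
    rw [mem_range] at hj
    have := hrowl j hj
    rw [if_neg (by omega), this.1]
  have d3 : ∏ i ∈ Ico (r + 1) n, (if (((s + 1 : ℕ) : ℤ) - r) - (μ.rowLen i - i) = 1 then (1 : K) else
      unkBr t ((((s + 1 : ℕ) : ℤ) - r) - (μ.rowLen i - i) - 1)) =
      ∏ i ∈ Ico (r + 1) n, unkBr t (unkL μ r - 1 - unkL μ i) := by
    refine prod_congr rfl fun i hi => ?_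
    rw [mem_Ico] at hi
    have := hbelow i (by omega)
    rw [if_neg (by omega)]
    congr 1
    simp only [unkL, hmr]; ring
  have d4 : ∏ i ∈ Ico (r + 1) n, unkBr t ((((s + 1 : ℕ) : ℤ) - r) - (μ.rowLen i - i)) =
      ∏ i ∈ Ico (r + 1) n, unkBr t (unkL μ r - unkL μ i) := by
    refine prod_congr rfl fun i hi => ?_
    simp only [unkL, hmr]
  rw [d4] at c1
  simp only [Nat.cast_one, if_true, mul_one, one_mul] at c2
  rw [d1, d2, d3] at c2
  have hMl : unkL μ r + n - 1 = (M : ℤ) := by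
    simp only [unkL, hmr]; omega
  have nz1 : ∏ j ∈ range s, unkBr t (hookLen l (r, j)) ≠ 0 :=
    prod_ne_zero_iff.2 fun j _ => hb _ (by simp only [hookLen]; omega)
  have nz2 : ∏ i ∈ Ico (r + 1) n, unkBr t (unkL μ r - unkL μ i) ≠ 0 :=
    prod_ne_zero_iff.2 fun i hi => hb _ (by
      rw [mem_Ico] at hi
      have := hbelow i (by omega)
      simp only [unkL, hmr]; omega)
  have nz3 : ∏ c ∈ l.cells, unkBr t (hookLen l c) ≠ 0 :=
    prod_ne_zero_iff.2 fun c _ => hb _ (by simp only [hookLen]; omega)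
  have hcolpart : ∏ i ∈ range r, (unkBr t (hookLen μ (i, s)) / unkBr t (hookLen l (i, s))) =
      ∏ i ∈ range r, (unkBr t (unkL μ r - 1 - unkL μ i) / unkBr t (unkL μ r - unkL μ i)) := by
    refine prod_congr rfl fun i hi => ?_
    rw [mem_range] at hi
    have h1 := hrowm i hi
    have h2 := hrow i (by omega)
    have e1 : unkL μ r - 1 - unkL μ i = - (hookLen μ (i, s) : ℤ) := by
      simp only [hookLen, armLen, legLen, unkL, hmr, hmc]; omega
    have e2 : unkL μ r - unkL μ i = - (hookLen l (i, s) : ℤ) := by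
      simp only [hookLen, armLen, legLen, unkL, hmr, hlc]; omega
    rw [e1, e2, unkBr_neg, unkBr_neg, neg_div_neg_eq]
  have herase : (range n).erase r = range r ∪ Ico (r + 1) n := by
    ext x; simp only [mem_erase, mem_range, mem_union, mem_Ico]; omega
  have hdis : Disjoint (range r) (Ico (r + 1) n) := by
    rw [Finset.disjoint_left]; intro x; simp only [mem_range, mem_Ico]; omega
  have hrowpart : unkBr t 1 * ∏ j ∈ range s, (unkBr t (hookLen μ (r, j)) / unkBr t (hookLen l (r, j)))
      = unkBr t M * ∏ i ∈ Ico (r + 1) n,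
        (unkBr t (unkL μ r - 1 - unkL μ i) / unkBr t (unkL μ r - unkL μ i)) := by
    rw [prod_div_distrib, prod_div_distrib, mul_div_assoc', mul_div_assoc', div_eq_div_iff nz1 nz2]
    rw [← c2] at c1
    push_cast at c1
    linear_combination c1
  have hB : ∏ c ∈ l.cells, unkBr t (hookLen μ c) = (∏ c ∈ l.cells, unkBr t (hookLen l c)) *
      ∏ c ∈ l.cells, (unkBr t (hookLen μ c) / unkBr t (hookLen l c)) := by
    rw [prod_div_distrib, mul_div_cancel₀ _ nz3]
  rw [hμ, prod_insert hrs, hcorner, hB, hA, hcolpart, unkR, herase, prod_union hdis, hMl]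
  push_cast
  linear_combination (∏ c ∈ l.cells, unkBr t (hookLen l c)) *
    (∏ i ∈ range r, (unkBr t (unkL μ r - 1 - unkL μ i) / unkBr t (unkL μ r - unkL μ i))) * hrowpart

theorem unk_sum_cells {K : Type*} [AddCommMonoid K] (μ : YoungDiagram) (g : ℕ × ℕ → K) :
    ∑ c ∈ μ.cells, g c = ∑ i ∈ range (μ.colLen 0), ∑ j ∈ range (μ.rowLen i), g (i, j) := by
  rw [← sum_fiberwise_of_maps_to (s := μ.cells) (t := range (μ.colLen 0)) (g := Prod.fst)]
  · refine sum_congr rfl fun i _ => ?_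
    have : μ.cells.filter (fun c => c.1 = i) = {i} ×ˢ range (μ.rowLen i) := YoungDiagram.row_eq_prod
    rw [this, sum_product]; simp
  · rintro ⟨i, j⟩ h
    rw [mem_range, ← YoungDiagram.mem_iff_lt_colLen]
    exact μ.up_left_mem le_rfl (Nat.zero_le _) h

theorem unk_identity {K : Type*} [Field K] (t : K) (ht : t ≠ 0)
    (hnz : ∀ m : ℤ, m ≠ 0 → t ^ m ≠ 1) (μ : YoungDiagram) (hpos : 0 < μ.colLen 0) :
    ∑ i ∈ range (μ.colLen 0), t ^ (unkL μ i - 1) * unkR t μ (μ.colLen 0) i =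
      (t - t⁻¹) * ∑ c ∈ μ.cells, t ^ (2 * cellContent c) := by
  set n := μ.colLen 0 with hn
  set X : ℕ → K := fun i => t ^ (2 * unkL μ i) with hX
  have hX0 : ∀ i, X i ≠ 0 := fun i => zpow_ne_zero _ ht
  have hq1 : t ^ 2 ≠ 1 := by simpa using hnz 2 (by norm_num)
  have hinj : Set.InjOn X (range n : Finset ℕ) := by
    intro a _ b _ hab
    by_contra hne
    have : unkL μ a ≠ unkL μ b := by
      simp only [unkL]
      rcases lt_or_gt_of_ne hne with h | h
      · have := μ.rowLen_anti a b h.le; omega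
      · have := μ.rowLen_anti b a h.le; omega
    apply hnz (2 * unkL μ a - 2 * unkL μ b) (by omega)
    rw [zpow_sub₀ ht]
    simp only [hX] at hab
    rw [hab, div_self (zpow_ne_zero _ ht)]
  have hne : (range n).Nonempty := ⟨0, mem_range.2 hpos⟩
  have hA := unk_lag_A (range n) hne X hinj hX0 (t ^ 2)
  have hB := unk_lag_B (range n) hne X hinj (t ^ 2) hq1
  rw [card_range] at hA
  -- rewrite each term
  have hterm : ∀ i ∈ range n, t ^ (unkL μ i - 1) * unkR t μ n i =
      t⁻¹ * ((X i - t ^ (2 - 2 * (n : ℤ))) *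
        ∏ j ∈ (range n).erase i, ((X i - t ^ 2 * X j) / (X i - X j))) := by
    intro i hi
    have hbr : ∀ j, unkBr t (unkL μ i - 1 - unkL μ j) / unkBr t (unkL μ i - unkL μ j) =
        t⁻¹ * ((X i - t ^ 2 * X j) / (X i - X j)) := by
      intro j
      have e1 : unkBr t (unkL μ i - unkL μ j) = t ^ (- unkL μ i - unkL μ j) * (X i - X j) := by
        simp only [unkBr, hX]
        rw [mul_sub, ← zpow_add₀ ht, ← zpow_add₀ ht]
        congr 2 <;> ring
      have e2 : unkBr t (unkL μ i - 1 - unkL μ j) =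
          t ^ (- unkL μ i - unkL μ j) * (t⁻¹ * (X i - t ^ 2 * X j)) := by
        simp only [unkBr, hX]
        rw [← zpow_natCast t 2, ← zpow_neg_one, mul_sub, mul_sub]
        simp only [← zpow_add₀ ht]
        congr 2 <;> push_cast <;> ring
      rw [e1, e2, mul_div_mul_left _ _ (zpow_ne_zero _ ht), mul_div_assoc]
    have e3 : unkBr t (unkL μ i + n - 1) = t ^ ((n : ℤ) - 1 - unkL μ i) *
        (X i - t ^ (2 - 2 * (n : ℤ))) := by
      simp only [unkBr, hX]
      rw [mul_sub, ← zpow_add₀ ht, ← zpow_add₀ ht]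
      congr 2 <;> ring
    have hcard : ((range n).erase i).card = n - 1 := by
      rw [card_erase_of_mem hi, card_range]
    rw [unkR, prod_congr rfl (fun j _ => hbr j), prod_mul_distrib, prod_const, hcard, e3]
    have e4 : t ^ (unkL μ i - 1) * t ^ ((n : ℤ) - 1 - unkL μ i) * t⁻¹ ^ (n - 1) = t⁻¹ := by
      rw [inv_pow, ← zpow_natCast t (n - 1), ← zpow_neg, ← zpow_add₀ ht, ← zpow_add₀ ht,
        ← zpow_neg_one]
      congr 1
      push_cast [Nat.sub_eq_of_eq_add, Nat.cast_sub (show 1 ≤ n from hpos)]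
      ring
    linear_combination ((X i - t ^ (2 - 2 * (n : ℤ))) *
        ∏ j ∈ (range n).erase i, ((X i - t ^ 2 * X j) / (X i - X j))) * e4
  rw [sum_congr rfl hterm, ← mul_sum]
  simp_rw [sub_mul]
  rw [sum_sub_distrib, ← mul_sum, hB]
  -- content sum
  have hC : (t ^ 2 - 1) * ∑ c ∈ μ.cells, t ^ (2 * cellContent c) =
      ∑ i ∈ range n, X i - ∑ i ∈ range n, t ^ (- (2 * (i : ℤ))) := by
    rw [unk_sum_cells, mul_sum, ← sum_sub_distrib]
    refine sum_congr rfl fun i _ => ?_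
    have e : ∀ j, t ^ (2 * cellContent (i, j)) = t ^ (-(2 * (i : ℤ))) * (t ^ 2) ^ j := by
      intro j
      rw [← pow_mul, ← zpow_natCast, ← zpow_add₀ ht]
      congr 1
      simp only [cellContent]; push_cast; ring
    simp_rw [e]
    rw [← mul_sum, mul_left_comm, mul_geom_sum, mul_sub, mul_one]
    congr 1
    simp only [hX, unkL]
    rw [← pow_mul, ← zpow_natCast, ← zpow_add₀ ht]
    congr 1
    push_cast; ring
  have hD : t ^ (2 - 2 * (n : ℤ)) * ∑ i ∈ range n, ∏ j ∈ (range n).erase i,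
      ((X i - t ^ 2 * X j) / (X i - X j)) = ∑ i ∈ range n, t ^ (- (2 * (i : ℤ))) := by
    have h1 : (1 - t ^ 2) ≠ 0 := sub_ne_zero.2 hq1.symm
    apply mul_left_cancel₀ h1
    rw [mul_left_comm, hA, ← mul_neg_geom_sum, mul_left_comm]
    congr 1
    rw [mul_sum, ← sum_range_reflect]
    refine sum_congr rfl fun i hi => ?_
    rw [mem_range] at hi
    rw [← pow_mul, ← zpow_natCast, ← zpow_add₀ ht]
    congr 1
    have : ((n - 1 - i : ℕ) : ℤ) = n - 1 - i := by omega
    push_cast [this]; ring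
  rw [hD, ← hC]
  field_simp

theorem unk_addCell {l μ : YoungDiagram} (h : AddCell l μ) :
    ∃ r s, (r, s) ∉ l.cells ∧ μ.cells = insert (r, s) l.cells := by
  obtain ⟨h1, h2⟩ := h
  have h3 : (μ.cells \ l.cells).card = 1 := by
    rw [card_sdiff_of_subset h1]
    change μ.cells.card = l.cells.card + 1 at h2
    omega
  obtain ⟨⟨r, s⟩, hc⟩ := card_eq_one.1 h3
  have h4 : (r, s) ∈ μ.cells \ l.cells := by rw [hc]; simp
  refine ⟨r, s, (mem_sdiff.1 h4).2, ?_⟩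
  rw [insert_eq, ← hc, sdiff_union_of_subset h1]

theorem unk_sdiff {l μ : YoungDiagram} {r s : ℕ} (hrs : (r, s) ∉ l.cells)
    (hμ : μ.cells = insert (r, s) l.cells) : μ.cells \ l.cells = {(r, s)} := by
  rw [hμ, insert_sdiff_of_notMem _ hrs]; simp

theorem unk_finsum {K : Type*} [AddCommMonoid K] (μ : YoungDiagram) (f : YoungDiagram → K) (g : ℕ → K)
    (hfg : ∀ l r s, (r, s) ∉ l.cells → μ.cells = insert (r, s) l.cells → f l = g r)
    (hg : ∀ r, r < μ.colLen 0 → μ.rowLen (r + 1) = μ.rowLen r → g r = 0) :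
    ∑ᶠ l ∈ {l : YoungDiagram | AddCell l μ}, f l = ∑ i ∈ range (μ.colLen 0), g i := by
  have he : ∀ (l : YoungDiagram) (r s : ℕ), (r, s) ∉ l.cells → μ.cells = insert (r, s) l.cells →
      ∑ c ∈ μ.cells \ l.cells, c.1 = r := fun l r s h1 h2 => by
    rw [unk_sdiff h1 h2]; simp
  have hbij : Set.BijOn (fun l : YoungDiagram => ∑ c ∈ μ.cells \ l.cells, c.1)
      {l : YoungDiagram | AddCell l μ}
      ((range (μ.colLen 0)).filter (fun r => μ.rowLen (r + 1) < μ.rowLen r) : Finset ℕ) := by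
    refine ⟨?_, ?_, ?_⟩
    · intro l hl
      obtain ⟨r, s, h1, h2⟩ := unk_addCell hl
      obtain ⟨⟨hlr, hmr⟩, ⟨hlc, hmc⟩, hrow, hcol⟩ := unk_rows h1 h2
      simp only [he l r s h1 h2, coe_filter, Set.mem_setOf_eq, mem_range]
      have := μ.colLen_anti 0 s (Nat.zero_le _)
      have h5 : μ.rowLen (r + 1) ≤ s := by rw [unk_rowLen_le]; omega
      omega
    · intro l hl l' hl' hll
      obtain ⟨r, s, h1, h2⟩ := unk_addCell hl
      obtain ⟨r', s', h1', h2'⟩ := unk_addCell hl'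
      simp only [he l r s h1 h2, he l' r' s' h1' h2'] at hll
      subst hll
      have a1 := (unk_rows h1 h2).1.2
      have a2 := (unk_rows h1' h2').1.2
      obtain rfl : s = s' := by omega
      ext1
      rw [← erase_insert h1, ← h2, h2', erase_insert h1']
    · intro r hr
      simp only [coe_filter, Set.mem_setOf_eq, mem_range] at hr
      have hmem : (r, μ.rowLen r - 1) ∈ μ.cells := YoungDiagram.mem_iff_lt_rowLen.2 (by omega)
      let l : YoungDiagram := ⟨μ.cells.erase (r, μ.rowLen r - 1), by
        rintro ⟨i, j⟩ ⟨i', j'⟩ hle h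
        rw [Prod.mk_le_mk] at hle
        simp only [coe_erase, Set.mem_diff, Set.mem_singleton_iff, mem_coe, Prod.mk.injEq] at h ⊢
        refine ⟨μ.up_left_mem hle.1 hle.2 h.1, ?_⟩
        rintro ⟨rfl, rfl⟩
        have h3 := YoungDiagram.mem_iff_lt_rowLen.1 h.1
        have h4 := h.2
        rcases eq_or_lt_of_le hle.1 with h5 | h5
        · subst h5; omega
        · have := μ.rowLen_anti (i' + 1) i h5
          omega⟩
      have h1 : (r, μ.rowLen r - 1) ∉ l.cells := notMem_erase _ _
      have h2 : μ.cells = insert (r, μ.rowLen r - 1) l.cells := (insert_erase hmem).symm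
      refine ⟨l, ⟨?_, ?_⟩, he l _ _ h1 h2⟩
      · exact erase_subset _ _
      · change μ.cells.card = l.cells.card + 1
        rw [h2, card_insert_of_notMem h1]
  rw [finsum_mem_eq_of_bijOn _ hbij (g := g), finsum_mem_coe_finset]
  · rw [sum_filter]
    refine sum_congr rfl fun r hr => ?_
    split_ifs with h
    · rfl
    · rw [mem_range] at hr
      have := μ.rowLen_anti r (r + 1) (by omega)
      exact (hg r hr (by omega)).symm
  · intro l hl
    obtain ⟨r, s, h1, h2⟩ := unk_addCell hl
    rw [hfg l r s h1 h2]
    simp only [he l r s h1 h2]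

theorem unk_vt_ne : vt ≠ 0 := RatFunc.X_ne_zero

theorem unk_va_ne : va ≠ 0 := by
  rw [va, Ne, map_eq_zero]; exact RatFunc.X_ne_zero

theorem unk_vt_nat (k : ℕ) (hk : k ≠ 0) : vt ^ k ≠ 1 := by
  intro h
  rw [vt, ← RatFunc.algebraMap_X, ← map_pow, ← map_one (algebraMap (Polynomial (RatFunc ℚ)) F2)] at h
  have h2 := RatFunc.algebraMap_injective _ h
  have h3 := congrArg Polynomial.natDegree h2
  simp at h3
  exact hk h3

theorem unk_vt_int (m : ℤ) (hm : m ≠ 0) : vt ^ m ≠ 1 := by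
  intro h
  rcases Int.natAbs_eq m with h1 | h1
  · rw [h1, zpow_natCast] at h
    exact unk_vt_nat _ (by omega) h
  · rw [h1, zpow_neg, zpow_natCast, inv_eq_one] at h
    exact unk_vt_nat _ (by omega) h

theorem unk_content_ne (μ : YoungDiagram) (h : μ.cells.Nonempty) : contentPolyT2 μ ≠ 0 := by
  intro h0
  set N : ℕ := ∑ c ∈ μ.cells, c.1 with hN
  set P : Polynomial (RatFunc ℚ) := ∑ c ∈ μ.cells, Polynomial.X ^ (2 * (N + c.2 - c.1)) with hP
  have h1 : algebraMap (Polynomial (RatFunc ℚ)) F2 P = vt ^ (2 * N) * contentPolyT2 μ := by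
    rw [hP, map_sum, contentPolyT2, mul_sum]
    refine sum_congr rfl fun c hc => ?_
    have hle : c.1 ≤ N := single_le_sum (f := fun c : ℕ × ℕ => c.1) (fun _ _ => Nat.zero_le _) hc
    rw [map_pow, RatFunc.algebraMap_X, ← vt, ← zpow_natCast, ← zpow_natCast, ← zpow_add₀ unk_vt_ne]
    congr 1
    simp only [cellContent]
    omega
  rw [h0, mul_zero, map_eq_zero_iff _ (RatFunc.algebraMap_injective _)] at h1
  have h2 := congrArg (Polynomial.eval 1) h1
  rw [hP, Polynomial.eval_finsetSum] at h2
  simp at h2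
  exact h.ne_empty h2

theorem unk_numer (c : ℤ) : va * vt ^ (2 * c) - va⁻¹ =
    vt ^ c * (va * vt ^ c - va⁻¹ * vt ^ (-c)) := by
  have h : vt ^ c * vt ^ (-c) = 1 := by rw [← zpow_add₀ unk_vt_ne]; simp
  rw [two_mul, zpow_add₀ unk_vt_ne]
  linear_combination va⁻¹ * h

end UnkAux

/-- Uniqueness: any solution of the second recursion for the unknot conormal is `ψ'_∅`
times the corresponding hook-content solution. -/
theorem unknot_recursion_unique' (γ : F2) (ψ' : YoungDiagram → F2)
    (hrec : ∀ μ : YoungDiagram, μ.cells.Nonempty →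
      (vt - vt⁻¹) * contentPolyT2 μ * ψ' μ =
        γ * ∑ᶠ l ∈ {l : YoungDiagram | AddCell l μ},
          (va * vt ^ (2 * newContent l μ) - va⁻¹) * ψ' l) :
    ∀ l : YoungDiagram,
      ψ' l = ψ' ⊥ * (γ ^ l.card * ∏ c ∈ l.cells,
        (va * vt ^ cellContent c - va⁻¹ * vt ^ (-cellContent c)) /
          (vt ^ (hookLen l c : ℤ) - vt ^ (-(hookLen l c : ℤ)))) := by
  have hb := unkBr_ne vt unk_vt_ne unk_vt_int
  have hH : ∀ l : YoungDiagram, ∏ c ∈ l.cells, unkBr vt (hookLen l c) ≠ 0 := fun l =>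
    prod_ne_zero_iff.2 fun c _ => hb _ (by simp only [hookLen]; omega)
  suffices hmain : ∀ (k : ℕ) (l : YoungDiagram), l.card = k → ψ' l = ψ' ⊥ * (γ ^ l.card *
      ((∏ c ∈ l.cells, (va * vt ^ cellContent c - va⁻¹ * vt ^ (-cellContent c))) /
        ∏ c ∈ l.cells, unkBr vt (hookLen l c))) by
    intro l
    rw [prod_div_distrib]
    exact hmain _ l rfl
  intro k
  induction k with
  | zero =>
    intro μ hμ
    have h0 : μ = ⊥ := by
      ext1
      rw [YoungDiagram.cells_bot]
      exact card_eq_zero.1 hμ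
    subst h0
    rw [hμ]
    simp
  | succ k ih =>
    intro μ hμ
    have hne : μ.cells.Nonempty := card_pos.1 (by change 0 < μ.card; omega)
    have hpos : 0 < μ.colLen 0 := by
      obtain ⟨⟨i, j⟩, h⟩ := hne
      have := YoungDiagram.mem_iff_lt_colLen.1
        (μ.up_left_mem (Nat.zero_le i) (Nat.zero_le j) h)
      omega
    have h1 := hrec μ hne
    set A : F2 := (∏ c ∈ μ.cells, (va * vt ^ cellContent c - va⁻¹ * vt ^ (-cellContent c))) /
        ∏ c ∈ μ.cells, unkBr vt (hookLen μ c) with hA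
    have h2 := unk_finsum μ (fun l => (va * vt ^ (2 * newContent l μ) - va⁻¹) * ψ' l)
      (fun i => (ψ' ⊥ * γ ^ k * A) * (vt ^ (unkL μ i - 1) * unkR vt μ (μ.colLen 0) i)) ?_ ?_
    · rw [h2, ← mul_sum, unk_identity vt unk_vt_ne unk_vt_int μ hpos] at h1
      have hv : vt - vt⁻¹ ≠ 0 := by simpa [unkBr] using hb 1 one_ne_zero
      apply mul_left_cancel₀ (mul_ne_zero hv (unk_content_ne μ hne))
      rw [h1, hμ, contentPolyT2]
      ring
    · intro l r s hl hm
      have hcard : μ.card = l.card + 1 := by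
        change μ.cells.card = l.cells.card + 1
        rw [hm, card_insert_of_notMem hl]
      have hlk : l.card = k := by omega
      obtain ⟨⟨hlr, hmr⟩, ⟨hlc, hmc⟩, hrow, hcol⟩ := unk_rows hl hm
      have hr : r < μ.colLen 0 := by
        have := μ.colLen_anti 0 s (Nat.zero_le _)
        omega
      have hrat := unk_ratio vt unk_vt_ne unk_vt_int hl hm (μ.colLen 0) le_rfl hr
      have hc : newContent l μ = cellContent (r, s) := by
        rw [newContent, unk_sdiff hl hm, sum_singleton]
      have hL : unkL μ r - 1 = cellContent (r, s) := by
        simp only [unkL, cellContent, hmr]; push_cast; ring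
      have hN : ∏ c ∈ μ.cells, (va * vt ^ cellContent c - va⁻¹ * vt ^ (-cellContent c)) =
          (va * vt ^ cellContent (r, s) - va⁻¹ * vt ^ (-cellContent (r, s))) *
          ∏ c ∈ l.cells, (va * vt ^ cellContent c - va⁻¹ * vt ^ (-cellContent c)) := by
        rw [hm, prod_insert hl]
      have hHl := hH l
      have hHm := hH μ
      rw [hrat] at hHm
      have hR := right_ne_zero_of_mul hHm
      rw [ih l hlk, hlk, hc, hL, hA, hN, hrat, unk_numer]
      generalize (∏ c ∈ l.cells, unkBr vt (hookLen l c)) = H at *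
      generalize unkR vt μ (μ.colLen 0) r = R at *
      field_simp
    · intro r hr heq
      have hr1 : r + 1 < μ.colLen 0 := by
        have h3 : 0 < μ.rowLen r := YoungDiagram.mem_iff_lt_rowLen.1
          (YoungDiagram.mem_iff_lt_colLen.2 hr)
        rw [← heq] at h3
        exact YoungDiagram.mem_iff_lt_colLen.1 (YoungDiagram.mem_iff_lt_rowLen.2 h3)
      have hz : unkR vt μ (μ.colLen 0) r = 0 := by
        rw [unkR]
        apply mul_eq_zero_of_right
        apply prod_eq_zero (i := r + 1) (by simp [hr1])
        have : unkL μ r - 1 - unkL μ (r + 1) = 0 := by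
          simp only [unkL, heq]; push_cast; ring
        rw [this]
        simp [unkBr]
      simp only [hz, mul_zero]
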